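/- Let φ be a Drinfeld A-module of rank r over F_p = A/p, and regard F_p as an A-module via φ (denoted ^φF_p), with invariant factor decomposition ^φF_p ≅ A/d₁ × ⋯ × A/d_r, d₁ | ⋯ | d_r. Then d₁ is the monic polynomial of largest degree such that p does not divide d₁ and all roots of the polynomial φ_{d₁}(x) lie in F_p. -/

import Mathlib

open Polynomial

/-- Twisted polynomial multiplication on `L{τ}` (`τ·c = c^q·τ`), modelled on `Polynomial L`. -/
noncomputable def tmul {L : Type*} [CommSemiring L] (q : ℕ) (f g : Polynomial L) : Polynomial L :=
  f.sum fun i a => g.sum fun j b => Polynomial.monomial (i + j) (a * b ^ q ^ i)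

/-- Evaluation of a twisted polynomial `Σ aᵢ τ^i ∈ L{τ}` at a point `x` of an `L`-algebra `M`,
namely `Σ aᵢ x^{q^i}`. -/
noncomputable def teval {L M : Type*} [CommSemiring L] [CommSemiring M] [Algebra L M]
    (q : ℕ) (f : Polynomial L) (x : M) : M :=
  f.sum fun i a => algebraMap L M a * x ^ q ^ i

/-- The ordinary polynomial `Σ aᵢ X^{q^i}` attached to a twisted polynomial. -/
noncomputable def linPoly {L : Type*} [CommSemiring L] (q : ℕ) (f : Polynomial L) :
    Polynomial L :=
  f.sum fun i a => Polynomial.monomial (q ^ i) a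

lemma aeval_linPoly {L M : Type*} [CommSemiring L] [CommSemiring M] [Algebra L M]
    (q : ℕ) (f : Polynomial L) (x : M) : aeval x (linPoly q f) = teval q f x := by
  simp [linPoly, teval, Polynomial.sum, map_sum, aeval_monomial]

lemma coeff_linPoly {L : Type*} [CommSemiring L] {q : ℕ} (hq : 1 < q) (f : Polynomial L)
    (n : ℕ) : (linPoly q f).coeff (q ^ n) = f.coeff n := by
  unfold linPoly Polynomial.sum
  rw [finsetSum_coeff]
  simp only [coeff_monomial, Nat.pow_right_inj hq]
  simp +contextual

lemma natDegree_linPoly {L : Type*} [CommSemiring L] {q : ℕ} (hq : 1 < q) {f : Polynomial L}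
    (hf : f ≠ 0) : (linPoly q f).natDegree = q ^ f.natDegree := by
  apply le_antisymm
  · unfold linPoly Polynomial.sum
    apply natDegree_sum_le_of_forall_le
    intro i hi
    refine (natDegree_monomial_le _).trans ?_
    exact Nat.pow_le_pow_right (by omega) (le_natDegree_of_mem_supp _ hi)
  · apply le_natDegree_of_ne_zero
    rw [coeff_linPoly hq]
    simpa using hf

lemma linPoly_ne_zero {L : Type*} [CommSemiring L] {q : ℕ} (hq : 1 < q) {f : Polynomial L}
    (hf : f ≠ 0) : linPoly q f ≠ 0 := by
  intro h
  have := coeff_linPoly hq f f.natDegree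
  rw [h] at this
  simp at this
  exact hf (leadingCoeff_eq_zero.1 this.symm)

lemma derivative_linPoly {L : Type*} [CommRing L] {q : ℕ} (hq0 : (q : L) = 0)
    (f : Polynomial L) : derivative (linPoly q f) = C (f.coeff 0) := by
  unfold linPoly Polynomial.sum
  rw [derivative_sum]
  have : ∀ i ∈ f.support, derivative (monomial (q ^ i) (f.coeff i)) =
      if i = 0 then C (f.coeff 0) else 0 := by
    intro i _
    rw [derivative_monomial]
    split_ifs with h
    · subst h; simp
    · simp [hq0, h]
  rw [Finset.sum_congr rfl this]
  simp +contextual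

lemma card_quot {F : Type*} [Field F] [Fintype F] (d : Polynomial F) (hd : d ≠ 0) :
    Finite (Polynomial F ⧸ Ideal.span {d}) ∧
    Nat.card (Polynomial F ⧸ Ideal.span {d}) = Fintype.card F ^ d.natDegree := by
  haveI : Module.Finite F (Polynomial F ⧸ Ideal.span {d}) :=
    (AdjoinRoot.powerBasis hd).finite
  refine ⟨Module.finite_of_finite F, ?_⟩
  rw [Module.natCard_eq_pow_finrank (K := F), finrank_quotient_span_eq_natDegree,
    Nat.card_eq_fintype_card]

lemma card_torsion {F : Type*} [Field F] [Fintype F] [DecidableEq F] (d m : Polynomial F)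
    (hd : d ≠ 0) :
    Nat.card {x : Polynomial F ⧸ Ideal.span {d} // m • x = 0} =
      Fintype.card F ^ (EuclideanDomain.gcd d m).natDegree := by
  classical
  obtain ⟨hfin, hcard⟩ := card_quot d hd
  let B := Polynomial F ⧸ Ideal.span {d}
  let f : B →ₗ[B] B := LinearMap.mulLeft B (Ideal.Quotient.mk (Ideal.span {d}) m : B)
  have h1 := Submodule.card_eq_card_quotient_mul_card (LinearMap.ker f)
  have h2 := Submodule.card_eq_card_quotient_mul_card (LinearMap.range f)
  have h3 := Nat.card_congr f.quotKerEquivRange.toEquiv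
  have h4 : Nat.card ((Polynomial F ⧸ Ideal.span {d}) ⧸ LinearMap.range f) =
      Nat.card (Polynomial F ⧸ Ideal.span {EuclideanDomain.gcd d m}) := by
    have e1 := (DoubleQuot.quotQuotEquivQuotSup (Ideal.span {d}) (Ideal.span {m})).toEquiv
    rw [← Ideal.span_union, Set.singleton_union, ← EuclideanDomain.span_gcd] at e1
    rw [← Nat.card_congr e1, Ideal.map_span, Set.image_singleton]
    have hr : LinearMap.range f = Ideal.span {Ideal.Quotient.mk (Ideal.span {d}) m} := by
      ext x
      rw [Ideal.mem_span_singleton']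
      constructor
      · rintro ⟨y, rfl⟩
        exact ⟨y, mul_comm _ _⟩
      · rintro ⟨y, rfl⟩
        exact ⟨y, mul_comm _ _⟩
    rw [hr]
  have hg : EuclideanDomain.gcd d m ≠ 0 := fun h => hd (EuclideanDomain.gcd_eq_zero_iff.1 h).1
  rw [(card_quot _ hg).2] at h4
  have h5 : 0 < Nat.card (LinearMap.range f) := Nat.card_pos
  have h6 : Nat.card (LinearMap.ker f) = Fintype.card F ^ (EuclideanDomain.gcd d m).natDegree := by
    rw [h3] at h1
    rw [h4] at h2
    have := h1.symm.trans h2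
    rw [mul_comm] at this
    exact Nat.eq_of_mul_eq_mul_left h5 this
  rw [← h6]
  refine Nat.card_congr (Equiv.subtypeEquivRight fun x => ?_)
  rw [LinearMap.mem_ker]
  obtain ⟨y, rfl⟩ := Ideal.Quotient.mk_surjective x
  rfl

/-- Let `φ` be a rank-`r` Drinfeld `A`-module over `F_p = A/p` and regard
`F_p` as an `A`-module `^φF_p` via `a • x = φ_a(x)`, with invariant factor decomposition
`^φF_p ≅ A/d₁ × ⋯ × A/d_r`, `d₁ ∣ ⋯ ∣ d_r` (monic).  Then `d₁` is the monic polynomial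
of largest degree such that `p ∤ d₁` and all roots of `φ_{d₁}(x)` (in an algebraic
closure `Ω`) lie in `F_p`. -/
theorem stmt18 (Fq : Type*) [Field Fq] [Fintype Fq]
    (p : Polynomial Fq) (hp : Irreducible p) [hmax : (Ideal.span {p}).IsMaximal]
    (Ω : Type*) [Field Ω] [Algebra (Polynomial Fq ⧸ Ideal.span {p}) Ω]
    [IsAlgClosed Ω] [Algebra.IsAlgebraic (Polynomial Fq ⧸ Ideal.span {p}) Ω]
    (r : ℕ) (hr : 1 ≤ r)
    (φ : Polynomial Fq → Polynomial (Polynomial Fq ⧸ Ideal.span {p}))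
    (hadd : ∀ a b, φ (a + b) = φ a + φ b)
    (hmul : ∀ a b, φ (a * b) = tmul (Fintype.card Fq) (φ a) (φ b))
    (hone : φ 1 = 1)
    (hrank : ∀ a : Polynomial Fq, a ≠ 0 → (φ a).natDegree = r * a.natDegree)
    (hconst : ∀ a : Polynomial Fq, (φ a).coeff 0 = Ideal.Quotient.mk (Ideal.span {p}) a)
    (dd : Fin r → Polynomial Fq) (hmon : ∀ i, (dd i).Monic)
    (hchain : ∀ i j : Fin r, i ≤ j → dd i ∣ dd j)
    (e : (Polynomial Fq ⧸ Ideal.span {p}) ≃+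
      ((i : Fin r) → Polynomial Fq ⧸ Ideal.span {dd i}))
    (hlin : ∀ (a : Polynomial Fq) (x : Polynomial Fq ⧸ Ideal.span {p}),
      e (teval (Fintype.card Fq) (φ a) x) = a • e x) :
    ((dd ⟨0, by omega⟩).Monic ∧ ¬ p ∣ dd ⟨0, by omega⟩ ∧
      (∀ x : Ω, teval (Fintype.card Fq) (φ (dd ⟨0, by omega⟩)) x = 0 →
        ∃ y : Polynomial Fq ⧸ Ideal.span {p},
          algebraMap (Polynomial Fq ⧸ Ideal.span {p}) Ω y = x)) ∧
    (∀ m : Polynomial Fq, m.Monic → ¬ p ∣ m →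
      (∀ x : Ω, teval (Fintype.card Fq) (φ m) x = 0 →
        ∃ y : Polynomial Fq ⧸ Ideal.span {p},
          algebraMap (Polynomial Fq ⧸ Ideal.span {p}) Ω y = x) →
      m.natDegree ≤ (dd ⟨0, by omega⟩).natDegree) ∧
    (∀ m : Polynomial Fq, m.Monic → ¬ p ∣ m →
      (∀ x : Ω, teval (Fintype.card Fq) (φ m) x = 0 →
        ∃ y : Polynomial Fq ⧸ Ideal.span {p},
          algebraMap (Polynomial Fq ⧸ Ideal.span {p}) Ω y = x) →
      m.natDegree = (dd ⟨0, by omega⟩).natDegree → m = dd ⟨0, by omega⟩) := by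
  classical
  set q := Fintype.card Fq with hqdef
  have hq : 1 < q := Fintype.one_lt_card
  letI : Field (Polynomial Fq ⧸ Ideal.span {p}) := Ideal.Quotient.field _
  have hq0 : ((q : ℕ) : Polynomial Fq ⧸ Ideal.span {p}) = 0 := by
    have h : ((q : ℕ) : Fq) = 0 := Nat.cast_card_eq_zero Fq
    have := congrArg (algebraMap Fq (Polynomial Fq ⧸ Ideal.span {p})) h
    simpa using this
  haveI := (card_quot p hp.ne_zero).1
  have hd0 : ∀ i, dd i ≠ 0 := fun i => (hmon i).ne_zero
  -- the number of torsion points over the base field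
  have htors : ∀ m : Polynomial Fq,
      Nat.card {x : Polynomial Fq ⧸ Ideal.span {p} // teval q (φ m) x = 0} =
        ∏ i, q ^ (EuclideanDomain.gcd (dd i) m).natDegree := by
    intro m
    have e1 : {x : Polynomial Fq ⧸ Ideal.span {p} // teval q (φ m) x = 0} ≃
        ((i : Fin r) → {x : Polynomial Fq ⧸ Ideal.span {dd i} // m • x = 0}) :=
      (e.toEquiv.subtypeEquiv (q := fun y => ∀ i, m • y i = 0) (by
        intro x
        rw [← e.map_eq_zero_iff, hlin, funext_iff]
        rfl)).trans (Equiv.subtypePiEquivPi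
          (p := fun i (x : Polynomial Fq ⧸ Ideal.span {dd i}) => m • x = 0))
    rw [Nat.card_congr e1, Nat.card_pi]
    exact Finset.prod_congr rfl fun i _ => card_torsion _ _ (hd0 i)
  have htors' : ∀ m : Polynomial Fq, m ≠ 0 → (∀ i, m ∣ dd i) →
      Nat.card {x : Polynomial Fq ⧸ Ideal.span {p} // teval q (φ m) x = 0} =
        q ^ (r * m.natDegree) := by
    intro m hm h
    rw [htors]
    have : ∀ i, (EuclideanDomain.gcd (dd i) m).natDegree = m.natDegree := fun i =>
      natDegree_eq_of_degree_eq (degree_eq_degree_of_associated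
        (associated_of_dvd_dvd (EuclideanDomain.gcd_dvd_right _ _)
          (EuclideanDomain.dvd_gcd (h i) dvd_rfl)))
    simp [this, ← pow_mul, mul_comm]
  have hmk : ∀ m : Polynomial Fq, (φ m).coeff 0 = 0 ↔ p ∣ m := by
    intro m
    rw [hconst, Ideal.Quotient.eq_zero_iff_mem, Ideal.mem_span_singleton]
  have hdeg : ∀ m : Polynomial Fq, m ≠ 0 → φ m ≠ 0 →
      (linPoly q (φ m)).natDegree = q ^ (r * m.natDegree) := by
    intro m hm h
    rw [natDegree_linPoly hq h, hrank m hm]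
  have hmin : ∀ i, dd ⟨0, by omega⟩ ∣ dd i := fun i => hchain _ _ (Nat.zero_le _)
  have hpd : ¬ p ∣ dd ⟨0, by omega⟩ := by
    intro hdvd
    have hc := htors' p hp.ne_zero (fun i => hdvd.trans (hmin i))
    have hφ : φ p ≠ 0 := by
      intro h
      have h1 := hrank p hp.ne_zero
      rw [h, natDegree_zero] at h1
      have := hp.natDegree_pos
      have : 0 < r * p.natDegree := Nat.mul_pos (by omega) this
      omega
    have hP0 := linPoly_ne_zero hq hφ
    have hder := derivative_linPoly hq0 (φ p)
    rw [(hmk p).2 dvd_rfl, C_0] at hder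
    rw [← hdeg p hp.ne_zero hφ] at hc
    set P := linPoly q (φ p) with hP
    have hroots : P.roots.toFinset.card = P.natDegree := by
      rw [← hc, Nat.subtype_card]
      intro x
      rw [Multiset.mem_toFinset, mem_roots hP0, IsRoot.def, ← coe_aeval_eq_eval, hP,
        aeval_linPoly]
    have hnd : P.roots.Nodup := by
      rw [← Multiset.toFinset_card_eq_card_iff_nodup]
      exact le_antisymm (Multiset.toFinset_card_le _) (hroots ▸ card_roots' P)
    have hne : P.roots.toFinset.Nonempty := by
      rw [← Finset.card_pos, hroots, hdeg p hp.ne_zero hφ]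
      positivity
    obtain ⟨x, hx⟩ := hne
    rw [Multiset.mem_toFinset, mem_roots hP0] at hx
    have h1 := (one_lt_rootMultiplicity_iff_isRoot hP0).2 ⟨hx, by rw [hder]; simp⟩
    have h2 := Multiset.nodup_iff_count_le_one.1 hnd x
    rw [count_roots] at h2
    omega
  have hφne : ∀ m : Polynomial Fq, ¬ p ∣ m → φ m ≠ 0 := by
    intro m hm h
    apply hm
    rw [← hmk, h, coeff_zero]
  have hinj : Function.Injective (algebraMap (Polynomial Fq ⧸ Ideal.span {p}) Ω) :=
    (algebraMap (Polynomial Fq ⧸ Ideal.span {p}) Ω).injective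
  have hteval : ∀ (m : Polynomial Fq) (x : Polynomial Fq ⧸ Ideal.span {p}),
      teval q (φ m) (algebraMap (Polynomial Fq ⧸ Ideal.span {p}) Ω x) =
        algebraMap _ Ω (teval q (φ m) x) := by
    intro m x
    rw [← aeval_linPoly, ← aeval_linPoly, aeval_algebraMap_apply]
  have hrs : ∀ m : Polynomial Fq, ¬ p ∣ m → ∀ x : Ω,
      x ∈ (linPoly q (φ m)).rootSet Ω ↔ teval q (φ m) x = 0 := by
    intro m hm x
    rw [mem_rootSet, aeval_linPoly]
    exact and_iff_right (linPoly_ne_zero hq (hφne m hm))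
  have himg : ∀ m : Polynomial Fq, ¬ p ∣ m →
      algebraMap (Polynomial Fq ⧸ Ideal.span {p}) Ω '' {x | teval q (φ m) x = 0} ⊆
        (linPoly q (φ m)).rootSet Ω := by
    rintro m hm _ ⟨x, hx, rfl⟩
    rw [hrs m hm, hteval, hx, map_zero]
  have hdvd : ∀ m : Polynomial Fq, m.Monic → ¬ p ∣ m →
      (∀ x : Ω, teval q (φ m) x = 0 →
        ∃ y : Polynomial Fq ⧸ Ideal.span {p},
          algebraMap (Polynomial Fq ⧸ Ideal.span {p}) Ω y = x) →
      m ∣ dd ⟨0, by omega⟩ := by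
    intro m hm hpm hall
    have hsep : (linPoly q (φ m)).Separable := by
      rw [separable_def, derivative_linPoly hq0]
      apply IsCoprime.symm
      have hu : IsUnit (C ((φ m).coeff 0)) :=
        isUnit_C.2 (isUnit_iff_ne_zero.2 fun h => hpm ((hmk m).1 h))
      obtain ⟨u, hu⟩ := hu
      exact ⟨↑u⁻¹, 0, by rw [← hu]; simp⟩
    have hcard := card_rootSet_eq_natDegree (K := Ω) hsep (IsAlgClosed.splits _)
    rw [hdeg m hm.ne_zero (hφne m hpm), ← Nat.card_eq_fintype_card, Nat.card_coe_set_eq] at hcard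
    have heq : algebraMap (Polynomial Fq ⧸ Ideal.span {p}) Ω '' {x | teval q (φ m) x = 0} =
        (linPoly q (φ m)).rootSet Ω := by
      refine (himg m hpm).antisymm ?_
      intro x hx
      rw [hrs m hpm] at hx
      obtain ⟨y, rfl⟩ := hall x hx
      refine ⟨y, ?_, rfl⟩
      rw [hteval] at hx
      exact hinj (hx.trans (map_zero _).symm)
    rw [← heq, Set.ncard_image_of_injective _ hinj, ← Nat.card_coe_set_eq] at hcard
    have h1 := (htors m).symm.trans hcard
    rw [Finset.prod_pow_eq_pow_sum] at h1
    have h2 := Nat.pow_right_injective hq h1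
    have hle : ∀ i ∈ Finset.univ,
        (EuclideanDomain.gcd (dd i) m).natDegree ≤ m.natDegree := fun i _ =>
      natDegree_le_of_dvd (EuclideanDomain.gcd_dvd_right _ _) hm.ne_zero
    have h3 := (Finset.sum_eq_sum_iff_of_le hle).1 (by simpa using h2) ⟨0, by omega⟩
      (Finset.mem_univ _)
    have h4 : Associated (EuclideanDomain.gcd (dd ⟨0, by omega⟩) m) m :=
      associated_of_dvd_of_natDegree_le (EuclideanDomain.gcd_dvd_right _ _) hm.ne_zero h3.ge
    exact h4.symm.dvd.trans (EuclideanDomain.gcd_dvd_left _ _)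
  refine ⟨⟨hmon _, hpd, ?_⟩, ?_, ?_⟩
  · intro x hx
    have hc := htors' _ (hd0 ⟨0, by omega⟩) hmin
    have hle : ((linPoly q (φ (dd ⟨0, by omega⟩))).rootSet Ω).ncard ≤
        (algebraMap (Polynomial Fq ⧸ Ideal.span {p}) Ω ''
          {x | teval q (φ (dd ⟨0, by omega⟩)) x = 0}).ncard := by
      rw [Set.ncard_image_of_injective _ hinj, ← Nat.card_coe_set_eq]
      refine le_trans ?_ hc.ge
      rw [← hdeg _ (hd0 _) (hφne _ hpd)]
      exact ncard_rootSet_le _ _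
    have := Set.eq_of_subset_of_ncard_le (himg _ hpd) hle (rootSet_finite _ _)
    rw [← hrs _ hpd, ← this] at hx
    obtain ⟨y, _, hy⟩ := hx
    exact ⟨y, hy⟩
  · intro m hm hpm hall
    exact natDegree_le_of_dvd (hdvd m hm hpm hall) (hd0 _)
  · intro m hm hpm hall hdeg'
    exact (eq_of_monic_of_dvd_of_natDegree_le hm (hmon _) (hdvd m hm hpm hall) hdeg'.ge).symm
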